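/- The incomplete symmetric 6×6 matrix A with rows (1,1,0,0,0,0), (1,1,1,*,1,0), (0,1,1,0,*,0), (0,*,0,1,1,0), (0,1,*,1,1,1), (0,0,0,0,1,1), where * denotes a missing entry, has no Robinsonian completion with values in {0,1}: no complete symmetric matrix agreeing with A on its non-missing entries and taking values 0 or 1 at the missing entries is Robinsonian. -/

import Mathlib

/-- An incomplete matrix (entries in `Option ℝ`, `none` = missing) is symmetric. -/
def IsSymmetricOpt {n : ℕ} (A : Fin n → Fin n → Option ℝ) : Prop :=
  ∀ i j, A j i = A i j

/-- Incomplete Robinson: non-missing entries do not decrease along rows and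
columns when moving toward the main diagonal. -/
def IsRobinsonOpt {n : ℕ} (A : Fin n → Fin n → Option ℝ) : Prop :=
  (∀ i k j : Fin n, i ≤ k → k ≤ j →
    ∀ x y : ℝ, A i j = some x → A i k = some y → x ≤ y) ∧
  (∀ i l j : Fin n, i ≤ l → l ≤ j →
    ∀ x y : ℝ, A i j = some x → A l j = some y → x ≤ y)

/-- Incomplete Strong-Robinson: `a_{i,j} ≤ a_{k,l}` whenever
`i ≤ k ≤ l ≤ j` and both entries are non-missing. -/
def IsStrongRobinsonOpt {n : ℕ} (A : Fin n → Fin n → Option ℝ) : Prop :=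
  ∀ i k l j : Fin n, i ≤ k → k ≤ l → l ≤ j →
    ∀ x y : ℝ, A i j = some x → A k l = some y → x ≤ y

/-- Incomplete Robinsonian: some simultaneous permutation of rows and columns is Robinson. -/
def IsRobinsonianOpt {n : ℕ} (A : Fin n → Fin n → Option ℝ) : Prop :=
  ∃ π : Equiv.Perm (Fin n), IsRobinsonOpt (fun i j => A (π i) (π j))

/-- Incomplete Strong-Robinsonian. -/
def IsStrongRobinsonianOpt {n : ℕ} (A : Fin n → Fin n → Option ℝ) : Prop :=
  ∃ π : Equiv.Perm (Fin n), IsStrongRobinsonOpt (fun i j => A (π i) (π j))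

/-- Complete Robinson matrix. -/
def IsRobinson {n : ℕ} (B : Fin n → Fin n → ℝ) : Prop :=
  (∀ i k j : Fin n, i ≤ k → k ≤ j → B i j ≤ B i k) ∧
  (∀ i l j : Fin n, i ≤ l → l ≤ j → B i j ≤ B l j)

/-- Complete Robinsonian matrix. -/
def IsRobinsonian {n : ℕ} (B : Fin n → Fin n → ℝ) : Prop :=
  ∃ π : Equiv.Perm (Fin n), IsRobinson (fun i j => B (π i) (π j))

/-- `B` is a (symmetric) completion of the incomplete matrix `A`. -/
def IsCompletion {n : ℕ} (A : Fin n → Fin n → Option ℝ) (B : Fin n → Fin n → ℝ) : Prop :=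
  (∀ i j, B j i = B i j) ∧ ∀ i j (x : ℝ), A i j = some x → B i j = x

/-- `w(A)`: the set of values appearing among the non-missing entries of `A`. -/
def valueSet {n : ℕ} (A : Fin n → Fin n → Option ℝ) : Set ℝ :=
  {x | ∃ i j, A i j = some x}

/-- The incomplete symmetric 6×6 matrix from the paper (`none` denotes a missing entry). -/
def Aex : Fin 6 → Fin 6 → Option ℝ :=
  ![![some 1, some 1, some 0, some 0, some 0, some 0],
    ![some 1, some 1, some 1, none,   some 1, some 0],
    ![some 0, some 1, some 1, some 0, none,   some 0],
    ![some 0, none,   some 0, some 1, some 1, some 0],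
    ![some 0, some 1, none,   some 1, some 1, some 1],
    ![some 0, some 0, some 0, some 0, some 1, some 1]]

/-- A Robinsonian matrix contains no claw. -/
theorem no_claw {n : ℕ} (B : Fin n → Fin n → ℝ) (hs : ∀ i j, B j i = B i j)
    (hR : IsRobinsonian B) (c a b d : Fin n)
    (ha : B c a = 1) (hb : B c b = 1) (hd : B c d = 1)
    (hab : B a b = 0) (had : B a d = 0) (hbd : B b d = 0) : False := by
  obtain ⟨π, h1, h2⟩ := hR
  have key : ∀ x y z : Fin n, π.symm x ≤ π.symm y → π.symm y ≤ π.symm z →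
      B x z ≤ B x y ∧ B x z ≤ B y z := by
    intro x y z hxy hyz
    have e1 := h1 _ _ _ hxy hyz
    have e2 := h2 _ _ _ hxy hyz
    simp only [Equiv.apply_symm_apply] at e1 e2
    exact ⟨e1, e2⟩
  -- two leaves cannot lie on the same side of the center
  have side : ∀ x y : Fin n, B c x = 1 → B c y = 1 → B x y = 0 →
      ¬ (π.symm x ≤ π.symm c ∧ π.symm y ≤ π.symm c) ∧
      ¬ (π.symm c ≤ π.symm x ∧ π.symm c ≤ π.symm y) := by
    intro x y hx hy hxy
    have hyx := hs x y
    have hx' := hs c x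
    have hy' := hs c y
    refine ⟨fun ⟨p, q⟩ => ?_, fun ⟨p, q⟩ => ?_⟩
    · rcases le_total (π.symm x) (π.symm y) with h | h
      · have := (key x y c h q).1
        linarith
      · have := (key y x c h p).1
        linarith
    · rcases le_total (π.symm x) (π.symm y) with h | h
      · have := (key c x y p h).2
        linarith
      · have := (key c y x q h).2
        linarith
  have s1 := side a b ha hb hab
  have s2 := side a d ha hd had
  have s3 := side b d hb hd hbd
  rcases le_total (π.symm a) (π.symm c) with p | p <;>
  rcases le_total (π.symm b) (π.symm c) with q | q <;>
  rcases le_total (π.symm d) (π.symm c) with r | r <;> tauto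

/-- The matrix `Aex` has no Robinsonian completion with values in `{0,1}`. -/
theorem stmt10 : ¬ ∃ B : Fin 6 → Fin 6 → ℝ,
    IsCompletion Aex B ∧
    (∀ i j, Aex i j = none → B i j ∈ ({0, 1} : Set ℝ)) ∧
    IsRobinsonian B := by
  rintro ⟨B, ⟨hs, hc⟩, hm, hR⟩
  have h10 : B 1 0 = 1 := hc 1 0 1 rfl
  have h12 : B 1 2 = 1 := hc 1 2 1 rfl
  have h14 : B 1 4 = 1 := hc 1 4 1 rfl
  have h41 : B 4 1 = 1 := hc 4 1 1 rfl
  have h43 : B 4 3 = 1 := hc 4 3 1 rfl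
  have h45 : B 4 5 = 1 := hc 4 5 1 rfl
  have h02 : B 0 2 = 0 := hc 0 2 0 rfl
  have h03 : B 0 3 = 0 := hc 0 3 0 rfl
  have h23 : B 2 3 = 0 := hc 2 3 0 rfl
  have h15 : B 1 5 = 0 := hc 1 5 0 rfl
  have h35 : B 3 5 = 0 := hc 3 5 0 rfl
  have h13 : B 1 3 = 0 ∨ B 1 3 = 1 := hm 1 3 rfl
  rcases h13 with h13 | h13
  · exact no_claw B hs hR 4 1 3 5 h41 h43 h45 h13 h15 h35
  · exact no_claw B hs hR 1 0 2 3 h10 h12 h13 h02 h03 h23
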